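/- Let g be in normal form of order 2n+2, fix n ≥ 1, and assume a_{i,1} = 0 for 2 ≤ i ≤ n (no condition when n = 1), a_{n+1,1} ≠ 0, and a_{2,0} ≠ 0. Then there exist ε > 0 and a C^∞ function φ : (−ε,ε) → ℝ such that Σ(t, φ(t)) = 0 for all |t| < ε, φ(0) = 0, φ^{(j)}(0) = 0 for 1 ≤ j ≤ n, and φ^{(n+1)}(0) = a_{n+1,1} b₂ / a_{2,0}. (Thus the parabolic set of the surface has a local branch which is tangent to the u-axis with at least (n+1)-point contact at the origin.) -/

import Mathlib

open Real Set

noncomputable section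

/-- Partial derivative in the first variable. -/
def pdu {F : Type*} [NormedAddCommGroup F] [NormedSpace ℝ F] (f : ℝ → ℝ → F) : ℝ → ℝ → F :=
  fun u w => deriv (fun t => f t w) u

/-- Partial derivative in the second variable. -/
def pdw {F : Type*} [NormedAddCommGroup F] [NormedSpace ℝ F] (f : ℝ → ℝ → F) : ℝ → ℝ → F :=
  fun u w => deriv (fun t => f u t) w

/-- Iterated partial derivative `∂_u^i ∂_w^j f`. -/
def pd {F : Type*} [NormedAddCommGroup F] [NormedSpace ℝ F] (i j : ℕ) (f : ℝ → ℝ → F) :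
    ℝ → ℝ → F :=
  pdu^[i] (pdw^[j] f)

/-- The Euclidean inner product on `ℝ³ = ℝ × ℝ × ℝ`. -/
def dot3 (x y : ℝ × ℝ × ℝ) : ℝ := x.1 * y.1 + x.2.1 * y.2.1 + x.2.2 * y.2.2

/-- The cross product on `ℝ³ = ℝ × ℝ × ℝ`. -/
def cross3 (x y : ℝ × ℝ × ℝ) : ℝ × ℝ × ℝ :=
  (x.2.1 * y.2.2 - x.2.2 * y.2.1, x.2.2 * y.1 - x.1 * y.2.2, x.1 * y.2.1 - x.2.1 * y.1)

/-- The Euclidean norm on `ℝ³ = ℝ × ℝ × ℝ`. -/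
def norm3 (x : ℝ × ℝ × ℝ) : ℝ := Real.sqrt (dot3 x x)

/-- The surface parameterization `g(u,w) = (u, p(u,w), q(u,w))`. -/
def gmap (p q : ℝ → ℝ → ℝ) : ℝ → ℝ → ℝ × ℝ × ℝ := fun u w => (u, p u w, q u w)

/-- The height function on the surface parameterized by `g = (u, p, q)` along `v`. -/
def hgt (p q : ℝ → ℝ → ℝ) (v : ℝ × ℝ × ℝ) : ℝ → ℝ → ℝ :=
  fun u w => dot3 (gmap p q u w) v

/-- `g = (u, p(u,w), q(u,w))` is in normal form of order `N`. -/
def NormalFormN (N : ℕ) (p q : ℝ → ℝ → ℝ) (b : ℕ → ℝ) (a : ℕ → ℕ → ℝ) : Prop :=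
  ContDiff ℝ (⊤ : ℕ∞) (fun x : ℝ × ℝ => p x.1 x.2) ∧
  ContDiff ℝ (⊤ : ℕ∞) (fun x : ℝ × ℝ => q x.1 x.2) ∧
  p 0 0 = 0 ∧ q 0 0 = 0 ∧
  pd 1 0 p 0 0 = 0 ∧ pd 0 1 p 0 0 = 0 ∧ pd 1 0 q 0 0 = 0 ∧ pd 0 1 q 0 0 = 0 ∧
  pd 0 2 p 0 0 = 1 ∧
  (∀ i, 2 ≤ i → i ≤ N → pd i 0 p 0 0 = b i) ∧
  (∀ i j, 2 ≤ i + j → i + j ≤ N → 1 ≤ j → ¬(i = 0 ∧ j = 2) → pd i j p 0 0 = 0) ∧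
  (∀ i j, 2 ≤ i + j → i + j ≤ N → pd i j q 0 0 = a i j) ∧
  a 1 1 = 0 ∧ a 0 2 = 0

/-- `h` has an `A_k` singularity at the origin: up to a `C^∞` change of coordinates fixing
the origin, `h` equals `h(0,0) ± x² ± y^(k+1)`. -/
def HasAkSingAt (h : ℝ → ℝ → ℝ) (k : ℕ) : Prop :=
  ∃ (U V : Set (ℝ × ℝ)) (φ ψ : ℝ × ℝ → ℝ × ℝ) (ε₁ ε₂ : ℝ),
    IsOpen U ∧ IsOpen V ∧ ((0, 0) : ℝ × ℝ) ∈ U ∧ ((0, 0) : ℝ × ℝ) ∈ V ∧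
    ContDiffOn ℝ (⊤ : ℕ∞) φ U ∧ ContDiffOn ℝ (⊤ : ℕ∞) ψ V ∧
    Set.MapsTo φ U V ∧ Set.MapsTo ψ V U ∧
    (∀ x ∈ U, ψ (φ x) = x) ∧ (∀ y ∈ V, φ (ψ y) = y) ∧
    φ (0, 0) = (0, 0) ∧ (ε₁ = 1 ∨ ε₁ = -1) ∧ (ε₂ = 1 ∨ ε₂ = -1) ∧
    ∀ x ∈ U, h (φ x).1 (φ x).2 = h 0 0 + ε₁ * x.1 ^ 2 + ε₂ * x.2 ^ (k + 1)

/-- The parabolic-set function `Σ = ⟨g_uu, g_u × g_w⟩⟨g_ww, g_u × g_w⟩ − ⟨g_uw, g_u × g_w⟩²`. -/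
def SigmaFun (p q : ℝ → ℝ → ℝ) : ℝ → ℝ → ℝ := fun u w =>
  dot3 (pd 2 0 (gmap p q) u w) (cross3 (pd 1 0 (gmap p q) u w) (pd 0 1 (gmap p q) u w)) *
      dot3 (pd 0 2 (gmap p q) u w) (cross3 (pd 1 0 (gmap p q) u w) (pd 0 1 (gmap p q) u w)) -
    dot3 (pd 1 1 (gmap p q) u w) (cross3 (pd 1 0 (gmap p q) u w) (pd 0 1 (gmap p q) u w)) ^ 2

/-- The torsion of a space curve `L`. -/
def tor (L : ℝ → ℝ × ℝ × ℝ) : ℝ → ℝ := fun t =>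
  dot3 (cross3 (deriv L t) (deriv (deriv L) t)) (deriv (deriv (deriv L)) t) /
    norm3 (cross3 (deriv L t) (deriv (deriv L) t)) ^ 2

/-- The unit binormal vector of a space curve `L` at `t = 0`. -/
def binormal0 (L : ℝ → ℝ × ℝ × ℝ) : ℝ × ℝ × ℝ :=
  (norm3 (cross3 (deriv L 0) (deriv (deriv L) 0)))⁻¹ • cross3 (deriv L 0) (deriv (deriv L) 0)

/-- `f` is a parabolic Monge form with `∂_w² f(0,0) = k₂ ≠ 0`. -/
def MongeForm (f : ℝ → ℝ → ℝ) (k₂ : ℝ) : Prop :=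
  ContDiff ℝ (⊤ : ℕ∞) (fun x : ℝ × ℝ => f x.1 x.2) ∧ f 0 0 = 0 ∧
  pd 1 0 f 0 0 = 0 ∧ pd 0 1 f 0 0 = 0 ∧
  pd 2 0 f 0 0 = 0 ∧ pd 1 1 f 0 0 = 0 ∧ pd 0 2 f 0 0 = k₂ ∧ k₂ ≠ 0

/-- The parabolic-set function `P = f_uu f_ww − f_uw²` of a Monge form. -/
def Pfun (f : ℝ → ℝ → ℝ) : ℝ → ℝ → ℝ := fun u w =>
  pd 2 0 f u w * pd 0 2 f u w - pd 1 1 f u w ^ 2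

open scoped ContDiff Topology
open Filter

/-- Integrating a `C^n` function over the last variable in `[0, 1]` gives a `C^n` function. -/
theorem contDiff_nat_intervalIntegral_zero_one {E : Type} [NormedAddCommGroup E]
    [NormedSpace ℝ E] [ProperSpace E] (n : ℕ) {F : Type} [NormedAddCommGroup F]
    [NormedSpace ℝ F] [CompleteSpace F] (f : E × ℝ → F) (hf : ContDiff ℝ n f) :
    ContDiff ℝ n (fun x => ∫ t in (0 : ℝ)..1, f (x, t)) := by
  induction n generalizing F with
  | zero =>
    simp only [Nat.cast_zero, contDiff_zero] at hf ⊢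
    exact intervalIntegral.continuous_parametric_intervalIntegral_of_continuous
      (f := fun x t => f (x, t)) hf continuous_const
  | succ n ih =>
    have hdiff : ContDiff ℝ n
        (fun z : E × ℝ => (fderiv ℝ f z).comp (ContinuousLinearMap.inl ℝ E ℝ)) :=
      (hf.fderiv_right (m := (n : ℕ∞ω)) (by push_cast; exact le_rfl)).clm_comp contDiff_const
    push_cast
    rw [contDiff_succ_iff_hasFDerivAt]
    refine ⟨fun x => ∫ t in (0 : ℝ)..1,
      (fderiv ℝ f (x, t)).comp (ContinuousLinearMap.inl ℝ E ℝ), ih _ hdiff, fun x₀ => ?_⟩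
    obtain ⟨C, hC⟩ := ((isCompact_closedBall x₀ 1).prod
      (isCompact_Icc (a := (0 : ℝ)) (b := 1))).exists_bound_of_continuousOn
      hdiff.continuous.continuousOn
    refine intervalIntegral.hasFDerivAt_integral_of_dominated_of_fderiv_le (𝕜 := ℝ)
      (μ := MeasureTheory.volume) (F := fun x t => f (x, t))
      (F' := fun x t => (fderiv ℝ f (x, t)).comp (ContinuousLinearMap.inl ℝ E ℝ))
      (bound := fun _ => C)
      (Metric.closedBall_mem_nhds x₀ one_pos) ?_ ?_ ?_ ?_ ?_ ?_
    · exact Eventually.of_forall fun x =>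
        (hf.continuous.comp (by fun_prop : Continuous fun t : ℝ => (x, t))).aestronglyMeasurable
    · exact (hf.continuous.comp
        (by fun_prop : Continuous fun t : ℝ => (x₀, t))).intervalIntegrable _ _
    · exact (hdiff.continuous.comp
        (by fun_prop : Continuous fun t : ℝ => (x₀, t))).aestronglyMeasurable
    · refine Eventually.of_forall fun t ht x hx => hC (x, t) ⟨hx, ?_⟩
      rw [Set.uIoc_of_le zero_le_one] at ht
      exact ⟨ht.1.le, ht.2⟩
    · exact intervalIntegrable_const
    · refine Eventually.of_forall fun t _ x _ => ?_
      have hfd : HasFDerivAt f (fderiv ℝ f (x, t)) (x, t) :=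
        (hf.differentiable (by simp) (x, t)).hasFDerivAt
      exact hfd.comp x (hasFDerivAt_prodMk_left x t)

/-- Hadamard's lemma in the second variable. -/
theorem exists_contDiff_eq_add_mul {f : ℝ × ℝ → ℝ} (hf : ContDiff ℝ ∞ f) :
    ∃ P : ℝ × ℝ → ℝ, ContDiff ℝ ∞ P ∧ ∀ u w, f (u, w) = f (u, 0) + w * P (u, w) := by
  have hd : ContDiff ℝ ∞ (fun z : (ℝ × ℝ) × ℝ => fderiv ℝ f (z.1.1, z.2 * z.1.2) (0, 1)) :=
    ((hf.fderiv_right (m := ∞) (by simp)).comp (by fun_prop)).clm_apply contDiff_const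
  refine ⟨fun x => ∫ t in (0 : ℝ)..1, fderiv ℝ f (x.1, t * x.2) (0, 1), ?_, fun u w => ?_⟩
  · rw [contDiff_infty]
    exact fun n => contDiff_nat_intervalIntegral_zero_one n _ (contDiff_infty.1 hd n)
  · have hder : ∀ t ∈ Set.uIcc (0 : ℝ) 1, HasDerivAt (fun t : ℝ => f (u, t * w))
        (w * fderiv ℝ f (u, t * w) (0, 1)) t := by
      intro t _
      have hfd : HasFDerivAt f (fderiv ℝ f (u, t * w)) (u, t * w) :=
        (hf.differentiable (by simp) _).hasFDerivAt
      have hline : HasDerivAt (fun t : ℝ => (u, t * w)) ((0 : ℝ), w) t := by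
        simpa using (hasDerivAt_const t u).prodMk ((hasDerivAt_id t).mul_const w)
      have hcomp := hfd.comp_hasDerivAt t hline
      rwa [show ((0 : ℝ), w) = w • ((0 : ℝ), (1 : ℝ)) by simp, map_smul, smul_eq_mul] at hcomp
    have hcont : Continuous fun t : ℝ => w * fderiv ℝ f (u, t * w) (0, 1) :=
      continuous_const.mul
        (hd.continuous.comp (by fun_prop : Continuous fun t : ℝ => ((u, w), t)))
    have hint := intervalIntegral.integral_eq_sub_of_hasDerivAt hder
      (hcont.intervalIntegrable _ _)
    rw [intervalIntegral.integral_const_mul] at hint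
    simp only [one_mul, zero_mul] at hint
    rw [hint]
    ring

theorem deriv_const_add_mul_self_zero {g : ℝ → ℝ} (hg : DifferentiableAt ℝ g 0) (c : ℝ) :
    deriv (fun w => c + w * g w) 0 = g 0 := by
  simpa using (((hasDerivAt_id (0 : ℝ)).mul hg.hasDerivAt).const_add c).deriv

theorem contDiff_infty_deriv {f : ℝ → ℝ} (hf : ContDiff ℝ ∞ f) : ContDiff ℝ ∞ (deriv f) :=
  (contDiff_infty_iff_deriv.1 hf).2

theorem deriv_pow_succ_mul {r : ℝ → ℝ} (hr : ContDiff ℝ ∞ r) (k : ℕ) :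
    deriv (fun x => x ^ (k + 1) * r x) = fun x => x ^ k * ((k + 1) * r x + x * deriv r x) := by
  ext x
  have hrx : HasDerivAt r (deriv r x) x := (hr.differentiable (by simp) x).hasDerivAt
  have h := ((hasDerivAt_pow (k + 1) x).mul hrx).deriv
  rw [add_tsub_cancel_right, Nat.cast_succ] at h
  exact h.trans (by ring)

theorem contDiff_succ_mul_add_mul_deriv {r : ℝ → ℝ} (hr : ContDiff ℝ ∞ r) (k : ℕ) :
    ContDiff ℝ ∞ (fun x => ((k : ℝ) + 1) * r x + x * deriv r x) :=
  (contDiff_const.mul hr).add (contDiff_id.mul (contDiff_infty_deriv hr))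

theorem iteratedDeriv_pow_mul_zero_of_lt {r : ℝ → ℝ} (hr : ContDiff ℝ ∞ r) {j k : ℕ}
    (hjk : j < k) : iteratedDeriv j (fun x => x ^ k * r x) 0 = 0 := by
  induction j generalizing k r with
  | zero => simp [iteratedDeriv_zero, hjk.ne']
  | succ j ih =>
    obtain ⟨k, rfl⟩ : ∃ m, k = m + 1 := ⟨k - 1, by omega⟩
    rw [iteratedDeriv_succ', deriv_pow_succ_mul hr]
    exact ih (contDiff_succ_mul_add_mul_deriv hr k) (by omega)

theorem iteratedDeriv_pow_mul_zero_self {r : ℝ → ℝ} (hr : ContDiff ℝ ∞ r) (k : ℕ) :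
    iteratedDeriv k (fun x => x ^ k * r x) 0 = k.factorial * r 0 := by
  induction k generalizing r with
  | zero => simp [iteratedDeriv_zero]
  | succ k ih =>
    rw [iteratedDeriv_succ', deriv_pow_succ_mul hr, ih (contDiff_succ_mul_add_mul_deriv hr k),
      Nat.factorial_succ]
    push_cast
    ring

/-- A smooth function whose derivatives of order less than `k` vanish at `0` is divisible by
`x ^ k`. -/
theorem exists_contDiff_eq_pow_mul {f : ℝ → ℝ} (hf : ContDiff ℝ ∞ f) {k : ℕ}
    (hk : ∀ j < k, iteratedDeriv j f 0 = 0) :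
    ∃ r : ℝ → ℝ, ContDiff ℝ ∞ r ∧ f = fun x => x ^ k * r x := by
  induction k with
  | zero => exact ⟨f, hf, by simp⟩
  | succ k ih =>
    obtain ⟨r, hr, rfl⟩ := ih fun j hj => hk j (by omega)
    have hr0 : r 0 = 0 := by
      have h := hk k (by omega)
      rw [iteratedDeriv_pow_mul_zero_self hr] at h
      exact (mul_eq_zero.1 h).resolve_left (by exact_mod_cast k.factorial_ne_zero)
    obtain ⟨P, hP, hrP⟩ := exists_contDiff_eq_add_mul (hr.comp contDiff_snd : ContDiff ℝ ∞
      fun z : ℝ × ℝ => r z.2)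
    refine ⟨fun x => P (0, x), hP.comp (by fun_prop), funext fun x => ?_⟩
    have hx : r x = r 0 + x * P (0, x) := hrP 0 x
    rw [hx, hr0]
    ring

/-- A function which is smooth near a point agrees near it with a globally smooth function. -/
theorem exists_contDiff_eventuallyEq {ψ : ℝ → ℝ} {x₀ : ℝ}
    (hψ : ∀ᶠ x in 𝓝 x₀, ContDiffAt ℝ ∞ ψ x) :
    ∃ ψ' : ℝ → ℝ, ContDiff ℝ ∞ ψ' ∧ ψ' =ᶠ[𝓝 x₀] ψ := by
  obtain ⟨δ, hδ, hball⟩ := Metric.eventually_nhds_iff_ball.1 hψ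
  let χ : ContDiffBump x₀ := ⟨δ / 3, δ / 2, by positivity, by linarith⟩
  refine ⟨fun x => χ x * ψ x, contDiff_iff_contDiffAt.2 fun x => ?_, ?_⟩
  · by_cases hx : x ∈ tsupport χ
    · rw [χ.tsupport_eq] at hx
      exact χ.contDiffAt.mul (hball x (Metric.closedBall_subset_ball (half_lt_self hδ) hx))
    · refine (contDiffAt_const (c := (0 : ℝ))).congr_of_eventuallyEq ?_
      filter_upwards [notMem_tsupport_iff_eventuallyEq.1 hx] with y hy
      simp [hy]
  · filter_upwards [χ.eventuallyEq_one] with x hx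
    simp [hx]

theorem isInvertible_of_apply_one_ne_zero {L : ℝ →L[ℝ] ℝ} (hL : L 1 ≠ 0) : L.IsInvertible := by
  refine ⟨ContinuousLinearEquiv.unitsEquivAut ℝ (Units.mk0 _ hL), ?_⟩
  ext
  simp

/-- The implicit function theorem in the plane, with a globally smooth solution. -/
theorem exists_contDiff_implicit {H : ℝ × ℝ → ℝ} (hH : ContDiff ℝ ∞ H) {u₀ v₀ c : ℝ}
    (hc : c ≠ 0) (hder : HasDerivAt (fun v => H (u₀, v)) c v₀) (h0 : H (u₀, v₀) = 0) :
    ∃ ψ : ℝ → ℝ, ContDiff ℝ ∞ ψ ∧ ψ u₀ = v₀ ∧ ∀ᶠ t in 𝓝 u₀, H (t, ψ t) = 0 := by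
  have hne : (∞ : ℕ∞ω) ≠ 0 := by simp
  have hcont : Continuous fun z => fderiv ℝ H z (0, 1) :=
    ((hH.fderiv_right (m := ∞) (by simp)).clm_apply contDiff_const).continuous
  have hinv : ∀ z, fderiv ℝ H z (0, 1) ≠ 0 →
      (fderiv ℝ H z ∘L .inr ℝ ℝ ℝ).IsInvertible := fun z hz =>
    isInvertible_of_apply_one_ne_zero (by simpa using hz)
  have hz₀ : fderiv ℝ H (u₀, v₀) (0, 1) ≠ 0 := by
    have h := (hH.differentiable hne (u₀, v₀)).hasFDerivAt.comp_hasDerivAt v₀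
      ((hasDerivAt_const v₀ u₀).prodMk (hasDerivAt_id v₀))
    rwa [h.unique hder]
  have hH₀ : ContDiffAt ℝ ∞ H (u₀, v₀) := hH.contDiffAt
  set ψ := hH₀.implicitFunction hne (hinv _ hz₀) with hψ
  have hψ₀ : ψ u₀ = v₀ := hH₀.implicitFunction_apply_self hne (hinv _ hz₀)
  have hψz : ∀ᶠ t in 𝓝 u₀, H (t, ψ t) = 0 := by
    simpa only [h0] using hH₀.eventually_apply_implicitFunction hne (hinv _ hz₀)
  have huniq : ∀ᶠ z in 𝓝 (u₀, v₀), H z = 0 ↔ ψ z.1 = z.2 := by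
    simpa only [h0] using hH₀.eventually_apply_eq_iff_implicitFunction hne (hinv _ hz₀)
  have hlim : Tendsto (fun t => (t, ψ t)) (𝓝 u₀) (𝓝 (u₀, v₀)) := by
    have hc := (hH₀.contDiffAt_implicitFunction hne (hinv _ hz₀)).continuousAt
    have h := continuousAt_id.prodMk hc
    rwa [ContinuousAt, ← hψ, hψ₀] at h
  have hsmooth : ∀ᶠ t in 𝓝 u₀, ContDiffAt ℝ ∞ ψ t := by
    filter_upwards [hψz, hlim.eventually huniq.eventually_nhds,
      hlim.eventually (hcont.continuousAt.eventually_ne hz₀)] with t ht htu htd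
    have hHt : ContDiffAt ℝ ∞ H (t, ψ t) := hH.contDiffAt
    have hsm := hHt.contDiffAt_implicitFunction hne (hinv _ htd)
    refine hsm.congr_of_eventuallyEq ?_
    have hlim' : Tendsto (fun s => (s, hHt.implicitFunction hne (hinv _ htd) s)) (𝓝 t)
        (𝓝 (t, ψ t)) := by
      have h := continuousAt_id.prodMk hsm.continuousAt
      rwa [ContinuousAt, hHt.implicitFunction_apply_self hne (hinv _ htd)] at h
    filter_upwards [hHt.eventually_apply_implicitFunction hne (hinv _ htd),
      hlim'.eventually htu] with s hs hsu
    exact hsu.1 (hs.trans ht)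
  obtain ⟨ψ', hψ', heq⟩ := exists_contDiff_eventuallyEq hsmooth
  refine ⟨ψ', hψ', heq.self_of_nhds.trans hψ₀, ?_⟩
  filter_upwards [heq, hψz] with t ht htz
  rwa [ht]

theorem hasDerivAt_fst_slice {f : ℝ → ℝ → ℝ}
    (hf : ContDiff ℝ ∞ (fun x : ℝ × ℝ => f x.1 x.2)) (u w : ℝ) :
    HasDerivAt (fun t => f t w) (fderiv ℝ (fun x : ℝ × ℝ => f x.1 x.2) (u, w) (1, 0)) u :=
  (hf.differentiable (by simp) (u, w)).hasFDerivAt.comp_hasDerivAt (f := fun t => (t, w)) u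
    ((hasDerivAt_id u).prodMk (hasDerivAt_const u w))

theorem hasDerivAt_snd_slice {f : ℝ → ℝ → ℝ}
    (hf : ContDiff ℝ ∞ (fun x : ℝ × ℝ => f x.1 x.2)) (u w : ℝ) :
    HasDerivAt (fun t => f u t) (fderiv ℝ (fun x : ℝ × ℝ => f x.1 x.2) (u, w) (0, 1)) w :=
  (hf.differentiable (by simp) (u, w)).hasFDerivAt.comp_hasDerivAt w
    ((hasDerivAt_const w u).prodMk (hasDerivAt_id w))

theorem contDiff_pdu {f : ℝ → ℝ → ℝ} (hf : ContDiff ℝ ∞ (fun x : ℝ × ℝ => f x.1 x.2)) :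
    ContDiff ℝ ∞ (fun x : ℝ × ℝ => pdu f x.1 x.2) := by
  simp only [pdu, (hasDerivAt_fst_slice hf _ _).deriv]
  exact (hf.fderiv_right (m := ∞) (by simp)).clm_apply contDiff_const

theorem contDiff_pdw {f : ℝ → ℝ → ℝ} (hf : ContDiff ℝ ∞ (fun x : ℝ × ℝ => f x.1 x.2)) :
    ContDiff ℝ ∞ (fun x : ℝ × ℝ => pdw f x.1 x.2) := by
  simp only [pdw, (hasDerivAt_snd_slice hf _ _).deriv]
  exact (hf.fderiv_right (m := ∞) (by simp)).clm_apply contDiff_const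

theorem pdu_iterate_apply (f : ℝ → ℝ → ℝ) (i : ℕ) (u w : ℝ) :
    pdu^[i] f u w = iteratedDeriv i (fun t => f t w) u := by
  induction i generalizing f with
  | zero => simp [iteratedDeriv_zero]
  | succ i ih => rw [Function.iterate_succ_apply, ih, iteratedDeriv_succ']; rfl

theorem pdu_triple {f h k : ℝ → ℝ → ℝ} (hf : ContDiff ℝ ∞ (fun x : ℝ × ℝ => f x.1 x.2))
    (hh : ContDiff ℝ ∞ (fun x : ℝ × ℝ => h x.1 x.2))
    (hk : ContDiff ℝ ∞ (fun x : ℝ × ℝ => k x.1 x.2)) :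
    pdu (fun u w => (f u w, h u w, k u w)) = fun u w => (pdu f u w, pdu h u w, pdu k u w) := by
  ext1 u
  ext1 w
  exact ((hasDerivAt_fst_slice hf u w).differentiableAt.hasDerivAt.prodMk
    ((hasDerivAt_fst_slice hh u w).differentiableAt.hasDerivAt.prodMk
      (hasDerivAt_fst_slice hk u w).differentiableAt.hasDerivAt)).deriv

theorem pdw_triple {f h k : ℝ → ℝ → ℝ} (hf : ContDiff ℝ ∞ (fun x : ℝ × ℝ => f x.1 x.2))
    (hh : ContDiff ℝ ∞ (fun x : ℝ × ℝ => h x.1 x.2))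
    (hk : ContDiff ℝ ∞ (fun x : ℝ × ℝ => k x.1 x.2)) :
    pdw (fun u w => (f u w, h u w, k u w)) = fun u w => (pdw f u w, pdw h u w, pdw k u w) := by
  ext1 u
  ext1 w
  exact ((hasDerivAt_snd_slice hf u w).differentiableAt.hasDerivAt.prodMk
    ((hasDerivAt_snd_slice hh u w).differentiableAt.hasDerivAt.prodMk
      (hasDerivAt_snd_slice hk u w).differentiableAt.hasDerivAt)).deriv

theorem sigmaFun_eq {p q : ℝ → ℝ → ℝ} (hp : ContDiff ℝ ∞ (fun x : ℝ × ℝ => p x.1 x.2))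
    (hq : ContDiff ℝ ∞ (fun x : ℝ × ℝ => q x.1 x.2)) (u w : ℝ) :
    SigmaFun p q u w =
      (pd 2 0 q u w * pdw p u w - pd 2 0 p u w * pdw q u w) *
          (pd 0 2 q u w * pdw p u w - pd 0 2 p u w * pdw q u w) -
        (pd 1 1 q u w * pdw p u w - pd 1 1 p u w * pdw q u w) ^ 2 := by
  have hu_const : ∀ c : ℝ, pdu (fun _ _ => c) = fun _ _ => (0 : ℝ) := fun c => by
    ext; simp [pdu]
  have hw_const : ∀ c : ℝ, pdw (fun _ _ => c) = fun _ _ => (0 : ℝ) := fun c => by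
    ext; simp [pdw]
  have hgu : pdu (gmap p q) = fun u w => (1, pdu p u w, pdu q u w) := by
    have h : pdu (fun u _ => u : ℝ → ℝ → ℝ) = fun _ _ => 1 := by ext; simp [pdu]
    exact (pdu_triple (f := fun u _ => u) contDiff_fst hp hq).trans (by rw [h])
  have hgw : pdw (gmap p q) = fun u w => (0, pdw p u w, pdw q u w) := by
    have h : pdw (fun u _ => u : ℝ → ℝ → ℝ) = fun _ _ => 0 := by ext; simp [pdw]
    exact (pdw_triple (f := fun u _ => u) contDiff_fst hp hq).trans (by rw [h])
  have hguu := pdu_triple (f := fun _ _ => 1) contDiff_const (contDiff_pdu hp) (contDiff_pdu hq)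
  have hguw := pdu_triple (f := fun _ _ => 0) contDiff_const (contDiff_pdw hp) (contDiff_pdw hq)
  have hgww := pdw_triple (f := fun _ _ => 0) contDiff_const (contDiff_pdw hp) (contDiff_pdw hq)
  rw [hu_const] at hguu hguw
  rw [hw_const] at hgww
  simp only [SigmaFun, pd, Function.iterate_succ, Function.iterate_zero, Function.comp_apply,
    id_eq, hguu, hguw, hgww, hgu, hgw, dot3, cross3]
  ring

/-- If the derivatives of `f (·, 0)` of order less than `k` vanish at `0`, then substituting
`w = u ^ k * v` makes `f` divisible by `u ^ k`. -/
theorem exists_contDiff_blowup {f : ℝ → ℝ → ℝ}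
    (hf : ContDiff ℝ ∞ (fun x : ℝ × ℝ => f x.1 x.2)) {k : ℕ} (hk0 : k ≠ 0)
    (hk : ∀ j < k, pdu^[j] f 0 0 = 0) :
    ∃ α : ℝ × ℝ → ℝ, ContDiff ℝ ∞ α ∧
      (∀ u v, f u (u ^ k * v) = u ^ k * α (u, v)) ∧
      ∀ v, α (0, v) = pdu^[k] f 0 0 / k.factorial + v * pdw f 0 0 := by
  simp only [pdu_iterate_apply] at hk ⊢
  obtain ⟨P, hP, hfP⟩ := exists_contDiff_eq_add_mul hf
  have hf0 : ContDiff ℝ ∞ fun t => f t 0 := hf.comp (contDiff_id.prodMk contDiff_const)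
  obtain ⟨r, hr, hfr⟩ := exists_contDiff_eq_pow_mul hf0 hk
  have hP0 : pdw f 0 0 = P (0, 0) := by
    have hPd : DifferentiableAt ℝ (fun w => P (0, w)) 0 :=
      (hP.comp (contDiff_const.prodMk contDiff_id)).differentiable (by simp) 0
    rw [← deriv_const_add_mul_self_zero hPd (f 0 0)]
    exact congrArg (deriv · 0) (funext fun w => hfP 0 w)
  refine ⟨fun x => r x.1 + x.2 * P (x.1, x.1 ^ k * x.2), ?_, fun u v => ?_, fun v => ?_⟩
  · exact (hr.comp contDiff_fst).add (contDiff_snd.mul (hP.comp (by fun_prop)))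
  · have h1 : f u (u ^ k * v) = f u 0 + u ^ k * v * P (u, u ^ k * v) := hfP u _
    have h2 : f u 0 = u ^ k * r u := congrFun hfr u
    rw [h1, h2]
    ring
  · rw [hfr, iteratedDeriv_pow_mul_zero_self hr, hP0,
      mul_div_cancel_left₀ _ (by exact_mod_cast k.factorial_ne_zero)]
    simp [hk0]

/-- under the stated conditions the parabolic set of `g` has a local smooth
branch `w = φ(u)` through the origin, tangent to the `u`-axis with at least `(n+1)`-point
contact, and `φ⁽ⁿ⁺¹⁾(0) = a_{n+1,1} b₂ / a_{2,0}`. -/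
theorem parabolic_branch_exists (p q : ℝ → ℝ → ℝ) (b : ℕ → ℝ) (a : ℕ → ℕ → ℝ)
    (n : ℕ) (hn : 1 ≤ n) (hNF : NormalFormN (2 * n + 2) p q b a)
    (hvan : ∀ i, 2 ≤ i → i ≤ n → a i 1 = 0) (hnz : a (n + 1) 1 ≠ 0) (ha20 : a 2 0 ≠ 0) :
    ∃ ε > (0 : ℝ), ∃ φ : ℝ → ℝ, ContDiff ℝ (⊤ : ℕ∞) φ ∧
      (∀ t : ℝ, |t| < ε → SigmaFun p q t (φ t) = 0) ∧
      φ 0 = 0 ∧ (∀ j, 1 ≤ j → j ≤ n → iteratedDeriv j φ 0 = 0) ∧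
      iteratedDeriv (n + 1) φ 0 = a (n + 1) 1 * b 2 / a 2 0 := by
  obtain ⟨hp, hq, -, -, -, hpw, -, hqw, hpww, hpb, hpv, hqa, ha11, ha02⟩ := hNF
  have hA : ∀ j < n + 1, pdu^[j] (pdw p) 0 0 = 0 := by
    intro j hj
    rcases Nat.eq_zero_or_pos j with rfl | hj0
    · exact hpw
    · exact hpv j 1 (by omega) (by omega) le_rfl (by omega)
  have hB : ∀ j < n + 1, pdu^[j] (pdw q) 0 0 = 0 := by
    intro j hj
    rcases Nat.eq_zero_or_pos j with rfl | hj0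
    · exact hqw
    · refine (hqa j 1 (by omega) (by omega)).trans ?_
      rcases Nat.lt_or_ge 1 j with h1 | h1
      · exact hvan j h1 (by omega)
      · rwa [show j = 1 by omega]
  obtain ⟨α, hα, hpα, hα0⟩ := exists_contDiff_blowup (k := n + 1) (contDiff_pdw hp) n.succ_ne_zero hA
  obtain ⟨β, hβ, hqβ, hβ0⟩ := exists_contDiff_blowup (k := n + 1) (contDiff_pdw hq) n.succ_ne_zero hB
  have hfac : ((n + 1).factorial : ℝ) ≠ 0 := by exact_mod_cast (n + 1).factorial_ne_zero
  have hα0' : ∀ v, α (0, v) = v := fun v => by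
    have h1 : pdu^[n + 1] (pdw p) 0 0 = 0 := hpv (n + 1) 1 (by omega) (by omega) le_rfl (by omega)
    have h2 : pdw (pdw p) 0 0 = 1 := hpww
    rw [hα0, h1, h2, zero_div, zero_add, mul_one]
  have hβ0' : ∀ v, β (0, v) = a (n + 1) 1 / (n + 1).factorial := fun v => by
    have h1 : pdu^[n + 1] (pdw q) 0 0 = a (n + 1) 1 := hqa (n + 1) 1 (by omega) (by omega)
    have h2 : pdw (pdw q) 0 0 = 0 := (hqa 0 2 (by omega) (by omega)).trans ha02
    rw [hβ0, h1, h2, mul_zero, add_zero]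
  have hblow : ContDiff ℝ ∞ fun x : ℝ × ℝ => (x.1, x.1 ^ (n + 1) * x.2) := by fun_prop
  let H : ℝ × ℝ → ℝ := fun x =>
    (pd 2 0 q x.1 (x.1 ^ (n + 1) * x.2) * α x - pd 2 0 p x.1 (x.1 ^ (n + 1) * x.2) * β x) *
        (pd 0 2 q x.1 (x.1 ^ (n + 1) * x.2) * α x - pd 0 2 p x.1 (x.1 ^ (n + 1) * x.2) * β x) -
      (pd 1 1 q x.1 (x.1 ^ (n + 1) * x.2) * α x - pd 1 1 p x.1 (x.1 ^ (n + 1) * x.2) * β x) ^ 2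
  have hH : ContDiff ℝ ∞ H :=
    (((((contDiff_pdu (contDiff_pdu hq)).comp hblow).mul hα).sub
      (((contDiff_pdu (contDiff_pdu hp)).comp hblow).mul hβ)).mul
      ((((contDiff_pdw (contDiff_pdw hq)).comp hblow).mul hα).sub
      (((contDiff_pdw (contDiff_pdw hp)).comp hblow).mul hβ))).sub
      (((((contDiff_pdu (contDiff_pdw hq)).comp hblow).mul hα).sub
      (((contDiff_pdu (contDiff_pdw hp)).comp hblow).mul hβ)).pow 2)
  have hSigma : ∀ u v, SigmaFun p q u (u ^ (n + 1) * v) = (u ^ (n + 1)) ^ 2 * H (u, v) := by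
    intro u v
    rw [sigmaFun_eq hp hq, hpα, hqβ]
    simp only [H]
    ring
  have hH0 : ∀ v, H (0, v) =
      (a 2 0 * v - b 2 * (a (n + 1) 1 / (n + 1).factorial)) * -(a (n + 1) 1 / (n + 1).factorial) := by
    intro v
    simp only [H, hα0', hβ0', zero_pow n.succ_ne_zero, zero_mul, hpww,
      hqa 2 0 (by omega) (by omega), hpb 2 le_rfl (by omega), hqa 0 2 (by omega) (by omega),
      hqa 1 1 (by omega) (by omega), hpv 1 1 (by omega) (by omega) le_rfl (by omega), ha11, ha02]
    ring
  have hder : HasDerivAt (fun v => H (0, v)) (a 2 0 * -(a (n + 1) 1 / (n + 1).factorial))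
      (b 2 * (a (n + 1) 1 / (n + 1).factorial) / a 2 0) := by
    simp only [hH0]
    simpa using (((hasDerivAt_id _).const_mul (a 2 0)).sub_const _).mul_const
      (-(a (n + 1) 1 / ((n + 1).factorial : ℝ)))
  obtain ⟨ψ, hψ, hψ0, hψH⟩ := exists_contDiff_implicit hH
    (mul_ne_zero ha20 (neg_ne_zero.2 (div_ne_zero hnz hfac))) hder
    (by rw [hH0, mul_div_cancel₀ _ ha20, sub_self, zero_mul])
  obtain ⟨ε, hε, hball⟩ := Metric.eventually_nhds_iff.1 hψH
  refine ⟨ε, hε, fun t => t ^ (n + 1) * ψ t, (contDiff_id.pow _).mul hψ, fun t ht => ?_, by simp,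
    fun j _ hj => iteratedDeriv_pow_mul_zero_of_lt hψ (by omega), ?_⟩
  · rw [hSigma, hball (by simpa using ht), mul_zero]
  · rw [iteratedDeriv_pow_mul_zero_self hψ, hψ0]
    field_simp
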